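/- arXiv:1909.00744 — 3 statements merged into one kernel-verified Lean document; each statement's English description precedes it below -/
import Mathlib

section
/- Let X be a reflexive real Banach space, i.e. the canonical embedding of X into its double dual X'' is surjective, and let ω : X × X → ℝ be a continuous antisymmetric bilinear form such that the induced map ω♭ : X → X', ω♭(x) = ω(x, ·), is injective. If the range of ω♭ is a closed subspace of the dual Banach space X', then ω♭ is surjective; that is, ω is a strongly symplectic form. -/
/-- **Closed-range weakly symplectic forms on reflexive Banach spaces are strongly
symplectic.**  Let `X` be a reflexive real Banach space and `ω` a continuous antisymmetric
bilinear form on `X` with injective `ω♭ : X → X'`.  If the range of `ω♭` is closed in the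
dual Banach space `X'`, then `ω♭` is surjective, i.e. `ω` is strongly symplectic. -/
theorem reflexive_closed_range_strongly_symplectic
    {X : Type*} [NormedAddCommGroup X] [NormedSpace ℝ X] [CompleteSpace X]
    (hrefl : Function.Surjective (NormedSpace.inclusionInDoubleDual ℝ X))
    (ω : X →L[ℝ] X →L[ℝ] ℝ)
    (hanti : ∀ x y, ω x y = -ω y x)
    (hinj : Function.Injective fun x => ω x)
    (hclosed : IsClosed (Set.range fun x => ω x)) :
    Function.Surjective fun x => ω x := by
  intro g
  by_contra hg
  have hconv : Convex ℝ (Set.range fun x => ω x) :=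
    (LinearMap.range (ω : X →ₗ[ℝ] X →L[ℝ] ℝ)).convex
  obtain ⟨f, u, hlt, hgt⟩ := geometric_hahn_banach_closed_point hconv hclosed hg
  obtain ⟨v, rfl⟩ := hrefl f
  have hbound : ∀ x, ω x v < u := fun x => hlt (ω x) ⟨x, rfl⟩
  have hzero : ∀ x, ω x v = 0 := by
    intro x
    by_contra hx
    have h := hbound ((u / ω x v) • x)
    simp [hx] at h
  have hv : v = 0 := hinj (by ext x; simp [hanti v x, hzero x])
  have hu : 0 < u := by simpa using hbound 0
  subst hv
  exact absurd hgt (by simpa using hu.le)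
end

section
/- For a function f : ℝ → ℝ define S f : ℝ → ℝ by (S f)(x) = x ∫₀ˣ f(y) dy − ∫₀ˣ y f(y) dy − ½(x² + 1) ∫₀¹ f(y) dy + ∫₀¹ y f(y) dy. Then: (a) for every f that is smooth on [0, 1], the function S f is smooth on [0, 1], its derivative satisfies (S f)'(0) = 0 and (S f)'(1) = 0, and its second derivative satisfies (S f)''(x) = f(x) − ∫₀¹ f(y) dy for all x ∈ [0, 1]; (b) for every u : ℝ → ℝ that is smooth on [0, 1] with u'(0) = 0 = u'(1), one has (S(u''))(x) = u(x) − u(1) for all x ∈ [0, 1]. Consequently, for the operator T u = u'' on the space of functions smooth on [0, 1] with vanishing derivative at both endpoints, one has T(S(T u)) = T u on [0, 1] and S(T(S f)) = S f on [0, 1]; that is, S is a reflexive generalized inverse of T. -/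
open intervalIntegral

/-- The generalized Green's operator for the Neumann boundary value problem `u'' = f`,
`u'(0) = u'(1) = 0` on `[0, 1]`. -/
noncomputable def greenOp (f : ℝ → ℝ) (x : ℝ) : ℝ :=
  x * (∫ y in (0:ℝ)..x, f y) - (∫ y in (0:ℝ)..x, y * f y)
    - (1 / 2) * (x ^ 2 + 1) * (∫ y in (0:ℝ)..1, f y) + (∫ y in (0:ℝ)..1, y * f y)

/-- The second derivative on `[0, 1]` (with one-sided derivatives at the endpoints). -/
noncomputable def secondDerivOn01 (u : ℝ → ℝ) : ℝ → ℝ :=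
  derivWithin (derivWithin u (Set.Icc 0 1)) (Set.Icc 0 1)

theorem hasDerivWithinAt_integral_unitInterval {f : ℝ → ℝ} (hf : ContinuousOn f (Set.Icc 0 1))
    {x : ℝ} (hx : x ∈ Set.Icc (0 : ℝ) 1) :
    HasDerivWithinAt (fun t => ∫ y in (0 : ℝ)..t, f y) (f x) (Set.Icc 0 1) x := by
  have : Fact (x ∈ Set.Icc (0 : ℝ) 1) := ⟨hx⟩
  refine integral_hasDerivWithinAt_right ?_ ?_ (hf x hx)
  · refine (hf.mono ?_).intervalIntegrable
    rw [Set.uIcc_of_le hx.1]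
    exact Set.Icc_subset_Icc_right hx.2
  · exact hf.stronglyMeasurableAtFilter_nhdsWithin measurableSet_Icc x

theorem hasDerivWithinAt_greenOp {f : ℝ → ℝ} (hf : ContinuousOn f (Set.Icc 0 1))
    {x : ℝ} (hx : x ∈ Set.Icc (0 : ℝ) 1) :
    HasDerivWithinAt (greenOp f) ((∫ y in (0 : ℝ)..x, f y) - x * ∫ y in (0 : ℝ)..1, f y)
      (Set.Icc 0 1) x := by
  have hid := hasDerivWithinAt_id x (Set.Icc (0 : ℝ) 1)
  have h := (((hid.mul (hasDerivWithinAt_integral_unitInterval hf hx)).sub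
    (hasDerivWithinAt_integral_unitInterval (continuousOn_id.mul hf) hx)).sub
    ((((hid.pow 2).add_const 1).const_mul (1 / 2)).mul_const (∫ y in (0 : ℝ)..1, f y))).add_const
    (∫ y in (0 : ℝ)..1, y * f y)
  refine h.congr_deriv ?_
  simp only [id, Pi.mul_apply]
  ring

theorem greenOp_one (f : ℝ → ℝ) : greenOp f 1 = 0 := by
  simp only [greenOp]
  ring

theorem derivWithin_greenOp {f : ℝ → ℝ} (hf : ContinuousOn f (Set.Icc 0 1))
    {x : ℝ} (hx : x ∈ Set.Icc (0 : ℝ) 1) :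
    derivWithin (greenOp f) (Set.Icc 0 1) x =
      (∫ y in (0 : ℝ)..x, f y) - x * ∫ y in (0 : ℝ)..1, f y :=
  (hasDerivWithinAt_greenOp hf hx).derivWithin (uniqueDiffOn_Icc_zero_one x hx)

theorem secondDerivOn01_greenOp {f : ℝ → ℝ} (hf : ContinuousOn f (Set.Icc 0 1))
    {x : ℝ} (hx : x ∈ Set.Icc (0 : ℝ) 1) :
    secondDerivOn01 (greenOp f) x = f x - ∫ y in (0 : ℝ)..1, f y := by
  have h := (hasDerivWithinAt_integral_unitInterval hf hx).sub
    ((hasDerivWithinAt_id x (Set.Icc (0 : ℝ) 1)).mul_const (∫ y in (0 : ℝ)..1, f y))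
  rw [secondDerivOn01, derivWithin_congr (fun y hy => derivWithin_greenOp hf hy)
    (derivWithin_greenOp hf hx)]
  exact (h.derivWithin (uniqueDiffOn_Icc_zero_one x hx)).trans (by rw [one_mul])

theorem contDiffOn_integral_unitInterval {f : ℝ → ℝ}
    (hf : ContDiffOn ℝ (⊤ : ℕ∞) f (Set.Icc 0 1)) :
    ContDiffOn ℝ (⊤ : ℕ∞) (fun t => ∫ y in (0 : ℝ)..t, f y) (Set.Icc 0 1) := by
  have h := fun x hx => hasDerivWithinAt_integral_unitInterval hf.continuousOn (x := x) hx
  rw [contDiffOn_infty_iff_derivWithin uniqueDiffOn_Icc_zero_one]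
  exact ⟨fun x hx => (h x hx).differentiableWithinAt,
    hf.congr fun x hx => (h x hx).derivWithin (uniqueDiffOn_Icc_zero_one x hx)⟩

theorem contDiffOn_greenOp {f : ℝ → ℝ} (hf : ContDiffOn ℝ (⊤ : ℕ∞) f (Set.Icc 0 1)) :
    ContDiffOn ℝ (⊤ : ℕ∞) (greenOp f) (Set.Icc 0 1) :=
  (((contDiffOn_id.mul (contDiffOn_integral_unitInterval hf)).sub
    (contDiffOn_integral_unitInterval (contDiffOn_id.mul hf))).sub
    ((contDiffOn_const.mul ((contDiffOn_id.pow 2).add contDiffOn_const)).mul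
      contDiffOn_const)).add contDiffOn_const

theorem contDiffOn_derivWithin_unitInterval {u : ℝ → ℝ}
    (hu : ContDiffOn ℝ (⊤ : ℕ∞) u (Set.Icc 0 1)) :
    ContDiffOn ℝ (⊤ : ℕ∞) (derivWithin u (Set.Icc 0 1)) (Set.Icc 0 1) :=
  ((contDiffOn_infty_iff_derivWithin uniqueDiffOn_Icc_zero_one).1 hu).2

theorem contDiffOn_secondDerivOn01 {u : ℝ → ℝ} (hu : ContDiffOn ℝ (⊤ : ℕ∞) u (Set.Icc 0 1)) :
    ContDiffOn ℝ (⊤ : ℕ∞) (secondDerivOn01 u) (Set.Icc 0 1) :=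
  contDiffOn_derivWithin_unitInterval (contDiffOn_derivWithin_unitInterval hu)

theorem integral_secondDerivOn01 {u : ℝ → ℝ} (hu : ContDiffOn ℝ (⊤ : ℕ∞) u (Set.Icc 0 1))
    {x : ℝ} (hx : x ∈ Set.Icc (0 : ℝ) 1) :
    ∫ y in (0 : ℝ)..x, secondDerivOn01 u y =
      derivWithin u (Set.Icc 0 1) x - derivWithin u (Set.Icc 0 1) 0 := by
  have hv := contDiffOn_derivWithin_unitInterval hu
  have hsub : Set.Icc 0 x ⊆ Set.Icc (0 : ℝ) 1 := Set.Icc_subset_Icc_right hx.2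
  refine integral_eq_sub_of_hasDerivAt_of_le hx.1 (hv.continuousOn.mono hsub) (fun y hy => ?_) ?_
  · have hy' : y ∈ Set.Icc (0 : ℝ) 1 := hsub (Set.Ioo_subset_Icc_self hy)
    exact ((hv.differentiableOn (by simp) y hy').hasDerivWithinAt).hasDerivAt
      (Icc_mem_nhds hy.1 (hy.2.trans_le hx.2))
  · refine ((contDiffOn_secondDerivOn01 hu).continuousOn.mono ?_).intervalIntegrable
    rwa [Set.uIcc_of_le hx.1]

theorem greenOp_secondDerivOn01 {u : ℝ → ℝ} (hu : ContDiffOn ℝ (⊤ : ℕ∞) u (Set.Icc 0 1))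
    (h0 : derivWithin u (Set.Icc 0 1) 0 = 0) (h1 : derivWithin u (Set.Icc 0 1) 1 = 0)
    {x : ℝ} (hx : x ∈ Set.Icc (0 : ℝ) 1) :
    greenOp (secondDerivOn01 u) x = u x - u 1 := by
  have hone : (1 : ℝ) ∈ Set.Icc (0 : ℝ) 1 := Set.right_mem_Icc.2 zero_le_one
  have hw := (contDiffOn_secondDerivOn01 hu).continuousOn
  have hd : ∀ y ∈ Set.Icc (0 : ℝ) 1,
      HasDerivWithinAt (greenOp (secondDerivOn01 u) - u) 0 (Set.Icc 0 1) y := fun y hy => by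
    refine ((hasDerivWithinAt_greenOp hw hy).sub
      (hu.differentiableOn (by simp) y hy).hasDerivWithinAt).congr_deriv ?_
    rw [integral_secondDerivOn01 hu hy, integral_secondDerivOn01 hu hone, h0, h1]
    ring
  have hc := constant_of_derivWithin_zero (fun y hy => (hd y hy).differentiableWithinAt)
    fun y hy => (hd y (Set.Ico_subset_Icc_self hy)).derivWithin
      (uniqueDiffOn_Icc_zero_one y (Set.Ico_subset_Icc_self hy))
  have h := (hc x hx).trans (hc 1 hone).symm
  simp only [Pi.sub_apply, greenOp_one] at h
  linarith

/-- **A reflexive generalized inverse for the Neumann problem `u'' = f` on `[0,1]`.**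
(a) For `f` smooth on `[0,1]`, `S f` is smooth on `[0,1]`, `(S f)'(0) = (S f)'(1) = 0` and
`(S f)'' = f − ∫₀¹ f`;  (b) for `u` smooth on `[0,1]` with `u'(0) = u'(1) = 0` one has
`S (u'') = u − u 1` on `[0,1]`.  Consequently `T (S (T u)) = T u` and `S (T (S f)) = S f`
on `[0,1]`, where `T u = u''`; that is, `S` is a reflexive generalized inverse of `T`. -/
theorem greenOp_reflexive_generalized_inverse :
    (∀ f : ℝ → ℝ, ContDiffOn ℝ (⊤ : ℕ∞) f (Set.Icc 0 1) →
      ContDiffOn ℝ (⊤ : ℕ∞) (greenOp f) (Set.Icc 0 1) ∧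
      derivWithin (greenOp f) (Set.Icc 0 1) 0 = 0 ∧
      derivWithin (greenOp f) (Set.Icc 0 1) 1 = 0 ∧
      ∀ x ∈ Set.Icc (0:ℝ) 1,
        secondDerivOn01 (greenOp f) x = f x - (∫ y in (0:ℝ)..1, f y)) ∧
    (∀ u : ℝ → ℝ, ContDiffOn ℝ (⊤ : ℕ∞) u (Set.Icc 0 1) →
      derivWithin u (Set.Icc 0 1) 0 = 0 → derivWithin u (Set.Icc 0 1) 1 = 0 →
      ∀ x ∈ Set.Icc (0:ℝ) 1, greenOp (secondDerivOn01 u) x = u x - u 1) ∧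
    (∀ u : ℝ → ℝ, ContDiffOn ℝ (⊤ : ℕ∞) u (Set.Icc 0 1) →
      derivWithin u (Set.Icc 0 1) 0 = 0 → derivWithin u (Set.Icc 0 1) 1 = 0 →
      ∀ x ∈ Set.Icc (0:ℝ) 1,
        secondDerivOn01 (greenOp (secondDerivOn01 u)) x = secondDerivOn01 u x) ∧
    (∀ f : ℝ → ℝ, ContDiffOn ℝ (⊤ : ℕ∞) f (Set.Icc 0 1) →
      ∀ x ∈ Set.Icc (0:ℝ) 1,
        greenOp (secondDerivOn01 (greenOp f)) x = greenOp f x) := by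
  have hzero : (0 : ℝ) ∈ Set.Icc (0 : ℝ) 1 := Set.left_mem_Icc.2 zero_le_one
  have hone : (1 : ℝ) ∈ Set.Icc (0 : ℝ) 1 := Set.right_mem_Icc.2 zero_le_one
  have hleft : ∀ f : ℝ → ℝ, ContDiffOn ℝ (⊤ : ℕ∞) f (Set.Icc 0 1) →
      derivWithin (greenOp f) (Set.Icc 0 1) 0 = 0 := fun f hf => by
    simp [derivWithin_greenOp hf.continuousOn hzero]
  have hright : ∀ f : ℝ → ℝ, ContDiffOn ℝ (⊤ : ℕ∞) f (Set.Icc 0 1) →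
      derivWithin (greenOp f) (Set.Icc 0 1) 1 = 0 := fun f hf => by
    simp [derivWithin_greenOp hf.continuousOn hone]
  refine ⟨fun f hf => ⟨contDiffOn_greenOp hf, hleft f hf, hright f hf,
      fun x hx => secondDerivOn01_greenOp hf.continuousOn hx⟩,
    fun u hu h0 h1 x hx => greenOp_secondDerivOn01 hu h0 h1 hx,
    fun u hu h0 h1 x hx => ?_, fun f hf x hx => ?_⟩
  · rw [secondDerivOn01_greenOp (contDiffOn_secondDerivOn01 hu).continuousOn hx,
      integral_secondDerivOn01 hu hone, h0, h1, sub_zero, sub_zero]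
  · rw [greenOp_secondDerivOn01 (contDiffOn_greenOp hf) (hleft f hf) (hright f hf) hx,
      greenOp_one, sub_zero]
end

section
/- On the phase space T*ℝ² = ℝ² × ℝ² of the two-dimensional isotropic harmonic oscillator, define the angular momentum J(q, p) = q₁p₂ − q₂p₁ and the map K(q, p) = (½‖p‖² − ½‖q‖², q · p, ½‖p‖² + ½‖q‖²) ∈ ℝ³. Then: (a) the image of the zero level set J⁻¹(0) under K is exactly the upper cone C = {(a, b, h) ∈ ℝ³ : h² = a² + b² and h ≥ 0}; (b) two points (q, p) and (q', p') of J⁻¹(0) satisfy K(q, p) = K(q', p') if and only if there exists a rotation R ∈ SO(2) with q' = R q and p' = R p. Hence K descends to a bijection from the quotient of J⁻¹(0) by the diagonal rotation action of SO(2) onto the cone C. -/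
/-- The angular momentum of the two-dimensional isotropic harmonic oscillator. -/
def angMom (q p : Fin 2 → ℝ) : ℝ := q 0 * p 1 - q 1 * p 0

/-- The invariants map `K(q, p) = (E₊, E₋, H)` of the two-dimensional isotropic harmonic
oscillator. -/
noncomputable def invMap (q p : Fin 2 → ℝ) : ℝ × ℝ × ℝ :=
  ((p 0 ^ 2 + p 1 ^ 2) / 2 - (q 0 ^ 2 + q 1 ^ 2) / 2,
   q 0 * p 0 + q 1 * p 1,
   (p 0 ^ 2 + p 1 ^ 2) / 2 + (q 0 ^ 2 + q 1 ^ 2) / 2)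

/-- Plane vectors of equal length differ by a rotation with matrix `!![c, -s; s, c]`. -/
theorem exists_rotation_of_sq_add_sq_eq {x y x' y' : ℝ}
    (h : x ^ 2 + y ^ 2 = x' ^ 2 + y' ^ 2) :
    ∃ c s : ℝ, c ^ 2 + s ^ 2 = 1 ∧ x' = c * x - s * y ∧ y' = s * x + c * y := by
  by_cases h0 : x ^ 2 + y ^ 2 = 0
  · have hx : x = 0 := by nlinarith [sq_nonneg x, sq_nonneg y]
    have hy : y = 0 := by nlinarith [sq_nonneg x, sq_nonneg y]
    have hx' : x' = 0 := by nlinarith [sq_nonneg x', sq_nonneg y']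
    have hy' : y' = 0 := by nlinarith [sq_nonneg x', sq_nonneg y']
    exact ⟨1, 0, by norm_num, by simp [hx, hx', hy], by simp [hx, hy, hy']⟩
  · refine ⟨(x * x' + y * y') / (x ^ 2 + y ^ 2), (x * y' - y * x') / (x ^ 2 + y ^ 2),
      ?_, ?_, ?_⟩
    · field_simp
      linear_combination -(x ^ 2 + y ^ 2) * h
    · field_simp
      ring
    · field_simp
      ring

/-- The zero level set of the angular momentum is mapped into the upper cone. -/
theorem invMap_mem_cone {q p : Fin 2 → ℝ} (hJ : angMom q p = 0) :
    (invMap q p).2.2 ^ 2 = (invMap q p).1 ^ 2 + (invMap q p).2.1 ^ 2 ∧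
      0 ≤ (invMap q p).2.2 := by
  simp only [angMom] at hJ
  simp only [invMap]
  exact ⟨by linear_combination (q 0 * p 1 - q 1 * p 0) * hJ, by positivity⟩

/-- Every point of the upper cone is the image of a collinear pair `(q, p)`. -/
theorem exists_invMap_eq {a b h : ℝ} (hc : h ^ 2 = a ^ 2 + b ^ 2) (hh : 0 ≤ h) :
    ∃ q p : Fin 2 → ℝ, angMom q p = 0 ∧ invMap q p = (a, b, h) := by
  obtain ⟨hl, hu⟩ := abs_le_of_sq_le_sq' (by nlinarith [sq_nonneg b] : a ^ 2 ≤ h ^ 2) hh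
  have hx := Real.sq_sqrt (sub_nonneg.2 hu)
  have hy := Real.sq_sqrt (by linarith : 0 ≤ h + a)
  have hxy : √(h - a) * √(h + a) = |b| := by
    rw [← Real.sqrt_mul (sub_nonneg.2 hu), ← Real.sqrt_sq_eq_abs]
    congr 1
    linear_combination hc
  obtain ⟨y, hy2, hb⟩ : ∃ y : ℝ, y ^ 2 = h + a ∧ √(h - a) * y = b := by
    rcases abs_choice b with hs | hs
    · exact ⟨√(h + a), hy, hxy.trans hs⟩
    · exact ⟨-√(h + a), by rw [neg_sq, hy], by linarith⟩
  refine ⟨![√(h - a), 0], ![y, 0], by simp [angMom], ?_⟩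
  simp only [invMap, Matrix.cons_val_zero, Matrix.cons_val_one, Prod.mk.injEq]
  refine ⟨?_, ?_, ?_⟩ <;> linarith

/-- The invariants map is constant on the orbits of the diagonal action of `O(2)`. -/
theorem invMap_mulVec {R : Matrix (Fin 2) (Fin 2) ℝ} (hR : R.transpose * R = 1)
    (q p : Fin 2 → ℝ) : invMap (R.mulVec q) (R.mulVec p) = invMap q p := by
  have h00 := congrFun (congrFun hR 0) 0
  have h01 := congrFun (congrFun hR 0) 1
  have h11 := congrFun (congrFun hR 1) 1
  simp [Matrix.mul_apply, Fin.sum_univ_two] at h00 h01 h11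
  simp only [invMap, Matrix.mulVec, dotProduct, Fin.sum_univ_two, Prod.mk.injEq]
  refine ⟨?_, ?_, ?_⟩
  · linear_combination (p 0 ^ 2 - q 0 ^ 2) / 2 * h00 + (p 0 * p 1 - q 0 * q 1) * h01 +
      (p 1 ^ 2 - q 1 ^ 2) / 2 * h11
  · linear_combination q 0 * p 0 * h00 + (q 0 * p 1 + q 1 * p 0) * h01 + q 1 * p 1 * h11
  · linear_combination (p 0 ^ 2 + q 0 ^ 2) / 2 * h00 + (p 0 * p 1 + q 0 * q 1) * h01 +
      (p 1 ^ 2 + q 1 ^ 2) / 2 * h11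

/-- Points of zero angular momentum with equal invariants differ by a rotation. -/
theorem exists_rotation_of_invMap_eq {q p q' p' : Fin 2 → ℝ} (hJ : angMom q p = 0)
    (hJ' : angMom q' p' = 0) (hK : invMap q p = invMap q' p') :
    ∃ R : Matrix (Fin 2) (Fin 2) ℝ, R.transpose * R = 1 ∧ R.det = 1 ∧
      q' = R.mulVec q ∧ p' = R.mulVec p := by
  simp only [angMom] at hJ hJ'
  simp only [invMap, Prod.mk.injEq] at hK
  obtain ⟨hdiff, hdot, hsum⟩ := hK
  have hq : q 0 ^ 2 + q 1 ^ 2 = q' 0 ^ 2 + q' 1 ^ 2 := by linarith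
  have hp : p 0 ^ 2 + p 1 ^ 2 = p' 0 ^ 2 + p' 1 ^ 2 := by linarith
  obtain ⟨c, s, hcs, hq0, hq1, hp0, hp1⟩ : ∃ c s : ℝ, c ^ 2 + s ^ 2 = 1 ∧
      q' 0 = c * q 0 - s * q 1 ∧ q' 1 = s * q 0 + c * q 1 ∧
      p' 0 = c * p 0 - s * p 1 ∧ p' 1 = s * p 0 + c * p 1 := by
    by_cases h0 : q 0 ^ 2 + q 1 ^ 2 = 0
    · obtain ⟨c, s, hcs, hp0, hp1⟩ := exists_rotation_of_sq_add_sq_eq hp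
      have hz0 : q 0 = 0 := by nlinarith [sq_nonneg (q 0), sq_nonneg (q 1)]
      have hz1 : q 1 = 0 := by nlinarith [sq_nonneg (q 0), sq_nonneg (q 1)]
      have hz0' : q' 0 = 0 := by nlinarith [sq_nonneg (q' 0), sq_nonneg (q' 1)]
      have hz1' : q' 1 = 0 := by nlinarith [sq_nonneg (q' 0), sq_nonneg (q' 1)]
      exact ⟨c, s, hcs, by simp [hz0, hz1, hz0'], by simp [hz0, hz1, hz1'], hp0, hp1⟩
    · obtain ⟨c, s, hcs, hq0, hq1⟩ := exists_rotation_of_sq_add_sq_eq hq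
      refine ⟨c, s, hcs, hq0, hq1, mul_left_cancel₀ h0 ?_, mul_left_cancel₀ h0 ?_⟩
      -- By collinearity `‖q‖² p = (q · p) q`, and likewise for the primed pair.
      · linear_combination p' 0 * hq - q' 1 * hJ' - q' 0 * hdot +
          (q 0 * p 0 + q 1 * p 1) * hq0 + (c * q 1 + s * q 0) * hJ
      · linear_combination p' 1 * hq + q' 0 * hJ' - q' 1 * hdot +
          (q 0 * p 0 + q 1 * p 1) * hq1 + (s * q 1 - c * q 0) * hJ
  refine ⟨!![c, -s; s, c], ?_, ?_, ?_, ?_⟩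
  · ext i j
    fin_cases i <;> fin_cases j <;> simp [Matrix.mul_apply, Fin.sum_univ_two] <;>
      linarith
  · rw [Matrix.det_fin_two_of]
    linarith
  · ext i
    fin_cases i <;> simp [hq0, hq1, Matrix.mulVec, dotProduct, Fin.sum_univ_two]
    ring
  · ext i
    fin_cases i <;> simp [hp0, hp1, Matrix.mulVec, dotProduct, Fin.sum_univ_two]
    ring

/-- **The reduced phase space of the isotropic harmonic oscillator is a cone.**
(a) The image of the zero level set `J⁻¹(0)` of the angular momentum under `K` is exactly
the upper cone `{(a, b, h) : h² = a² + b², h ≥ 0}`;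
(b) two points of `J⁻¹(0)` have the same image under `K` iff they differ by the diagonal
action of a rotation `R ∈ SO(2)`.  Hence `K` descends to a bijection from
`J⁻¹(0)/SO(2)` onto the cone. -/
theorem harmonic_oscillator_reduced_cone :
    ({v : ℝ × ℝ × ℝ | ∃ q p : Fin 2 → ℝ, angMom q p = 0 ∧ invMap q p = v} =
      {v : ℝ × ℝ × ℝ | v.2.2 ^ 2 = v.1 ^ 2 + v.2.1 ^ 2 ∧ 0 ≤ v.2.2}) ∧
    ∀ q p q' p' : Fin 2 → ℝ, angMom q p = 0 → angMom q' p' = 0 →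
      (invMap q p = invMap q' p' ↔
        ∃ R : Matrix (Fin 2) (Fin 2) ℝ, R.transpose * R = 1 ∧ R.det = 1 ∧
          q' = R.mulVec q ∧ p' = R.mulVec p) := by
  refine ⟨Set.ext fun ⟨a, b, h⟩ => ⟨?_, fun ⟨hc, hh⟩ => exists_invMap_eq hc hh⟩, ?_⟩
  · rintro ⟨q, p, hJ, hK⟩
    simpa only [hK, Set.mem_ofPred_eq] using invMap_mem_cone hJ
  · refine fun q p q' p' hJ hJ' => ⟨exists_rotation_of_invMap_eq hJ hJ', ?_⟩
    rintro ⟨R, hR, -, rfl, rfl⟩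
    exact (invMap_mulVec hR q p).symm
end
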